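/- Uniform single-site moment bound for the specification. For every λ > 0, every p ∈ [p₀, q), every α ∈ (α_, ᾱ], every ξ ∈ L^p(V,w_α), and every vertex x ∈ V, there exists a constant C(λ,p,x,ξ) > 0, independent of Λ, such that for every finite set Λ ⊂ V containing x, log ∫_Ω exp(λ|ω(x)|^p) π_Λ(dω|ξ) ≤ C(λ,p,x,ξ). -/

import Mathlib

open MeasureTheory Real Filter

noncomputable section

variable {V : Type} [Countable V] [DecidableEq V]

/-- The configuration equal to `σ` on `Λ` and to `ξ` off `Λ`. -/
def comb (Λ : Finset V) (σ : ↥Λ → ℝ) (ξ : V → ℝ) : V → ℝ :=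
  fun x => if h : x ∈ Λ then σ ⟨x, h⟩ else ξ x

/-- The relative local Hamiltonian `H_Λ(·|ξ)`, evaluated at the full configuration
`ω = ω_Λ × ξ_{Λᶜ}`: the sum of `W(ω(x),ω(y))` over edges with both ends in `Λ`,
plus the sum of `W(ω(x),ω(y))` over edges with `x ∈ Λ`, `y ∉ Λ`, plus `Σ_{x∈Λ} V(ω(x))`. -/
def ham (G : SimpleGraph V) [∀ v : V, Fintype (G.neighborSet v)]
    (W : ℝ → ℝ → ℝ) (P : ℝ → ℝ) (Λ : Finset V) (ω : V → ℝ) : ℝ :=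
  (∑ x ∈ Λ, ∑ y ∈ G.neighborFinset x ∩ Λ, W (ω x) (ω y)) / 2
    + ∑ x ∈ Λ, ∑ y ∈ G.neighborFinset x \ Λ, W (ω x) (ω y)
    + ∑ x ∈ Λ, P (ω x)

/-- The normalizing constant `Z_Λ(ξ)`. -/
def partZ (G : SimpleGraph V) [∀ v : V, Fintype (G.neighborSet v)]
    (W : ℝ → ℝ → ℝ) (P : ℝ → ℝ) (Λ : Finset V) (ξ : V → ℝ) : ℝ :=
  ∫ σ : ↥Λ → ℝ, Real.exp (- ham G W P Λ (comb Λ σ ξ))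

/-- The local Gibbs specification kernel `π_Λ(·|ξ)`, a measure on `Ω = ℝ^V`. -/
def gibbsKer (G : SimpleGraph V) [∀ v : V, Fintype (G.neighborSet v)]
    (W : ℝ → ℝ → ℝ) (P : ℝ → ℝ) (Λ : Finset V) (ξ : V → ℝ) : Measure (V → ℝ) :=
  (ENNReal.ofReal (partZ G W P Λ ξ))⁻¹ •
    Measure.map (fun σ => comb Λ σ ξ)
      ((volume : Measure (↥Λ → ℝ)).withDensity
        fun σ => ENNReal.ofReal (Real.exp (- ham G W P Λ (comb Λ σ ξ))))

/-- `μ` is a Gibbs measure: a probability measure solving the DLR equation. -/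
def IsGibbsMeasure (G : SimpleGraph V) [∀ v : V, Fintype (G.neighborSet v)]
    (W : ℝ → ℝ → ℝ) (P : ℝ → ℝ) (μ : Measure (V → ℝ)) : Prop :=
  IsProbabilityMeasure μ ∧
    ∀ (Λ : Finset V) (A : Set (V → ℝ)), MeasurableSet A →
      μ A = ∫⁻ ω, gibbsKer G W P Λ ω A ∂μ

/-- The weight `w_α(x) = exp(-α ρ(o,x))`. -/
def wgt (G : SimpleGraph V) (o : V) (α : ℝ) (x : V) : ℝ :=
  Real.exp (-α * (G.dist o x : ℝ))

/-- `‖ω‖_{p,α}^p = Σ_{x∈V} |ω(x)|^p w_α(x)`. -/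
def sNorm (G : SimpleGraph V) (o : V) (p α : ℝ) (ω : V → ℝ) : ℝ :=
  ∑' x : V, |ω x| ^ p * wgt G o α x

/-- The set `L^p(V, w_α)` of tempered configurations. -/
def tempered (G : SimpleGraph V) (o : V) (p α : ℝ) : Set (V → ℝ) :=
  {ω | Summable fun x : V => |ω x| ^ p * wgt G o α x}

/-- The summability `Θ(α,θ) = Σ_x Σ_{y∼x} [n(x)n(y)]^θ w_α(x) < ∞`. -/
def ThetaFin (G : SimpleGraph V) [∀ v : V, Fintype (G.neighborSet v)]
    (o : V) (α θ : ℝ) : Prop :=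
  Summable fun x : V =>
    (∑ y ∈ G.neighborFinset x, ((G.degree x : ℝ) * (G.degree y : ℝ)) ^ θ) * wgt G o α x

set_option linter.unusedSectionVars false

/-- Young's inequality with explicit constant. -/
theorem mul_rpow_le_mul_rpow_add {r p ε b t : ℝ} (hr : 0 < r) (hrp : r < p) (hε : 0 < ε)
    (hb : 0 ≤ b) (ht : 0 ≤ t) :
    b * t ^ r ≤ ε * t ^ p + b * (b / ε) ^ (r / (p - r)) := by
  have hpr : 0 < p - r := sub_pos.2 hrp
  have hbε : 0 ≤ b / ε := div_nonneg hb hε.le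
  have hsplit : t ^ p = t ^ r * t ^ (p - r) := by
    rw [← rpow_add_of_nonneg ht hr.le hpr.le]; congr 1; ring
  have htr : 0 ≤ t ^ r := rpow_nonneg ht r
  rcases le_total (b / ε) (t ^ (p - r)) with h | h
  · have h1 : b ≤ t ^ (p - r) * ε := (div_le_iff₀ hε).1 h
    have h2 : 0 ≤ b * (b / ε) ^ (r / (p - r)) := mul_nonneg hb (rpow_nonneg hbε _)
    rw [hsplit]
    nlinarith [mul_le_mul_of_nonneg_right h1 htr]
  · have h1 : t ^ r ≤ (b / ε) ^ (r / (p - r)) := by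
      have := rpow_le_rpow (rpow_nonneg ht _) h (div_nonneg hr.le hpr.le)
      rwa [← rpow_mul ht, mul_div_cancel₀ _ hpr.ne'] at this
    have h2 : 0 ≤ ε * t ^ p := mul_nonneg hε.le (rpow_nonneg ht p)
    linarith [mul_le_mul_of_nonneg_left h1 hb]

theorem exists_weighted_young {r θ p ε J : ℝ} (hr : 0 < r) (hθ : 0 < θ) (hp : r + r / θ ≤ p)
    (hε : 0 < ε) (hJ : 0 < J) :
    ∃ c : ℝ, 0 ≤ c ∧ ∀ N t : ℝ, 1 ≤ N → 0 ≤ t →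
      N * (J * t ^ r) ≤ ε * t ^ p + c * N ^ (1 + θ) := by
  have hrθ : 0 < r / θ := div_pos hr hθ
  have hrp : r < p := by linarith
  have hpr : 0 < p - r := sub_pos.2 hrp
  have hs : r / (p - r) ≤ θ := by
    rw [div_le_iff₀ hpr]
    have : r / θ ≤ p - r := by linarith
    rw [div_le_iff₀ hθ] at this
    linarith
  have hJε : 0 ≤ J / ε := (div_pos hJ hε).le
  refine ⟨J * (J / ε) ^ (r / (p - r)), mul_nonneg hJ.le (rpow_nonneg hJε _), fun N t hN ht => ?_⟩
  have hN0 : 0 < N := by linarith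
  have h := mul_rpow_le_mul_rpow_add (b := N * J) hr hrp hε (by positivity) ht
  have h1 : N ^ (r / (p - r)) ≤ N ^ θ := rpow_le_rpow_of_exponent_le hN hs
  have h2 : (N * J / ε) ^ (r / (p - r)) = N ^ (r / (p - r)) * (J / ε) ^ (r / (p - r)) := by
    rw [mul_div_assoc, mul_rpow hN0.le hJε]
  rw [h2] at h
  rw [rpow_add hN0, rpow_one]
  calc N * (J * t ^ r) = N * J * t ^ r := by ring
    _ ≤ _ := h
    _ = ε * t ^ p + N * J * (J / ε) ^ (r / (p - r)) * N ^ (r / (p - r)) := by ring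
    _ ≤ ε * t ^ p + N * J * (J / ε) ^ (r / (p - r)) * N ^ θ := by gcongr
    _ = _ := by ring

theorem integrable_exp_neg_mul_abs_rpow {b q : ℝ} (hq : 0 < q) (hb : 0 < b) :
    Integrable fun u : ℝ => Real.exp (-b * |u| ^ q) := by
  apply Integrable.of_integral_ne_zero
  rw [integral_comp_abs (f := fun u => Real.exp (-b * u ^ q)), integral_exp_neg_mul_rpow hq hb]
  have : 0 < Real.Gamma (1 / q + 1) := Real.Gamma_pos_of_pos (by positivity)
  positivity

theorem lintegral_exp_sub_mul_abs_rpow_lt_top {b q : ℝ} (hq : 0 < q) (hb : 0 < b) (K : ℝ) :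
    ∫⁻ u : ℝ, ENNReal.ofReal (Real.exp (K - b * |u| ^ q)) < ⊤ := by
  have h := ((integrable_exp_neg_mul_abs_rpow hq hb).const_mul (Real.exp K)).lintegral_lt_top
  refine lt_of_le_of_lt (lintegral_mono fun u => le_of_eq ?_) h
  rw [← Real.exp_add]; congr 2; ring

/-- A discrete Gronwall-type bound for a substochastic weighted system. -/
theorem le_of_weighted_contraction {ι : Type*} (Λ : Finset ι) (w M D : ι → ℝ) (S : ℝ)
    (hw : ∀ x, 0 < w x) (hM : ∀ x ∈ Λ, 0 ≤ M x) (hMD : ∀ x ∈ Λ, M x ≤ D x)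
    (hD : ∑ x ∈ Λ, w x * D x ≤ S + (∑ x ∈ Λ, w x * M x) / 2) {x : ι} (hx : x ∈ Λ) :
    M x ≤ 2 * S / w x := by
  have h1 : ∑ x ∈ Λ, w x * M x ≤ ∑ x ∈ Λ, w x * D x :=
    Finset.sum_le_sum fun y hy => mul_le_mul_of_nonneg_left (hMD y hy) (hw y).le
  have h2 : w x * M x ≤ ∑ x ∈ Λ, w x * M x :=
    Finset.single_le_sum (f := fun x => w x * M x)
      (fun y hy => mul_nonneg (hw y).le (hM y hy)) hx
  rw [le_div_iff₀ (hw x)]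
  linarith

theorem wgt_le_of_adj (G : SimpleGraph V) (hconn : G.Connected) (o : V) (α : ℝ) {x y : V}
    (h : G.Adj x y) : wgt G o α x ≤ Real.exp |α| * wgt G o α y := by
  unfold wgt
  rw [← Real.exp_add]
  apply Real.exp_le_exp.2
  have hxy : G.dist x y = 1 := SimpleGraph.dist_eq_one_iff_adj.2 h
  have hyx : G.dist y x = 1 := SimpleGraph.dist_eq_one_iff_adj.2 h.symm
  have h1 : G.dist o y ≤ G.dist o x + 1 := hxy ▸ hconn.dist_triangle
  have h2 : G.dist o x ≤ G.dist o y + 1 := hyx ▸ hconn.dist_triangle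
  have h1' : (G.dist o y : ℝ) ≤ G.dist o x + 1 := by exact_mod_cast h1
  have h2' : (G.dist o x : ℝ) ≤ G.dist o y + 1 := by exact_mod_cast h2
  have h3 : |(G.dist o y : ℝ) - G.dist o x| ≤ 1 := abs_le.2 ⟨by linarith, by linarith⟩
  have h4 : α * ((G.dist o y : ℝ) - G.dist o x) ≤ |α| := by
    calc α * ((G.dist o y : ℝ) - G.dist o x) ≤ |α * ((G.dist o y : ℝ) - G.dist o x)| :=
          le_abs_self _
      _ = |α| * |(G.dist o y : ℝ) - G.dist o x| := abs_mul _ _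
      _ ≤ |α| * 1 := by gcongr
      _ = |α| := mul_one _
  linarith

/-- The weight `m_θ(x) = Σ_{y∼x} [n(x)n(y)]^θ`. -/
def edgeMass (G : SimpleGraph V) [∀ v : V, Fintype (G.neighborSet v)] (θ : ℝ) (x : V) : ℝ :=
  ∑ y ∈ G.neighborFinset x, ((G.degree x : ℝ) * (G.degree y : ℝ)) ^ θ

theorem one_le_degree_of_adj (G : SimpleGraph V) [∀ v : V, Fintype (G.neighborSet v)] {x y : V}
    (h : G.Adj x y) : (1 : ℝ) ≤ G.degree x := by
  have : 0 < G.degree x := (G.degree_pos_iff_exists_adj x).2 ⟨y, h⟩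
  exact_mod_cast this

theorem edgeMass_nonneg (G : SimpleGraph V) [∀ v : V, Fintype (G.neighborSet v)] (θ : ℝ) (x : V) :
    0 ≤ edgeMass G θ x :=
  Finset.sum_nonneg fun _ _ => rpow_nonneg (by positivity) _

theorem degree_rpow_le_edgeMass (G : SimpleGraph V) [∀ v : V, Fintype (G.neighborSet v)] {θ : ℝ}
    (hθ : 0 < θ) (x : V) : (G.degree x : ℝ) ^ (1 + θ) ≤ edgeMass G θ x := by
  have h0 : (0 : ℝ) ≤ G.degree x := by positivity
  have h1 : (G.degree x : ℝ) ^ (1 + θ) = ∑ _y ∈ G.neighborFinset x, (G.degree x : ℝ) ^ θ := by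
    rw [Finset.sum_const, SimpleGraph.card_neighborFinset_eq_degree, nsmul_eq_mul,
      rpow_add_of_nonneg h0 zero_le_one hθ.le, rpow_one]
  rw [h1]
  refine Finset.sum_le_sum fun y hy => rpow_le_rpow h0 ?_ hθ.le
  have := one_le_degree_of_adj G ((G.mem_neighborFinset x y).1 hy).symm
  nlinarith

theorem degree_le_edgeMass (G : SimpleGraph V) [∀ v : V, Fintype (G.neighborSet v)] {θ : ℝ}
    (hθ : 0 < θ) (x : V) : (G.degree x : ℝ) ≤ edgeMass G θ x := by
  refine le_trans ?_ (degree_rpow_le_edgeMass G hθ x)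
  rcases Nat.eq_zero_or_pos (G.degree x) with h | h
  · rw [h]; simp; positivity
  · exact self_le_rpow_of_one_le (by exact_mod_cast h) (by linarith)

theorem abs_sum_interaction_le (G : SimpleGraph V) [∀ v : V, Fintype (G.neighborSet v)]
    {W : ℝ → ℝ → ℝ} {IW JW r : ℝ}
    (hW : ∀ u v : ℝ, |W u v| ≤ (IW + JW * (|u| ^ r + |v| ^ r)) / 2)
    (x : V) (ω : V → ℝ) (u : ℝ) :
    |∑ y ∈ G.neighborFinset x, W u (ω y)| ≤
      (G.degree x * IW + G.degree x * JW * |u| ^ r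
        + ∑ y ∈ G.neighborFinset x, JW * |ω y| ^ r) / 2 := by
  calc |∑ y ∈ G.neighborFinset x, W u (ω y)|
      ≤ ∑ y ∈ G.neighborFinset x, |W u (ω y)| := Finset.abs_sum_le_sum_abs _ _
    _ ≤ ∑ y ∈ G.neighborFinset x, ((IW + JW * |u| ^ r) / 2 + (JW * |ω y| ^ r) / 2) :=
        Finset.sum_le_sum fun y _ => (hW u (ω y)).trans (le_of_eq (by ring))
    _ = _ := by
        rw [Finset.sum_add_distrib, Finset.sum_const, SimpleGraph.card_neighborFinset_eq_degree,
          nsmul_eq_mul, ← Finset.sum_div]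
        ring

/-- The exponential moments of the one-point kernel, in unnormalized form. -/
theorem exists_single_site_bound (G : SimpleGraph V) [∀ v : V, Fintype (G.neighborSet v)]
    {θ : ℝ} (hθ : 0 < θ) {W : ℝ → ℝ → ℝ} {IW JW r : ℝ} (hIW : 0 < IW) (hJW : 0 < JW) (hr : 0 < r)
    (hW : ∀ u v : ℝ, |W u v| ≤ (IW + JW * (|u| ^ r + |v| ^ r)) / 2)
    {P : ℝ → ℝ} (hPcont : Continuous P) {aV cV q : ℝ} (haV : 0 < aV) (hcV : 0 < cV)
    (hP : ∀ u : ℝ, aV * |u| ^ q - cV ≤ P u)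
    {lam p κ : ℝ} (hlam : 0 < lam) (hp : p ∈ Set.Ico (r + r / θ) q) (hκ : 0 < κ) :
    ∃ C : ℝ, 0 ≤ C ∧ ∀ (x : V) (ω : V → ℝ),
      ∫⁻ u, ENNReal.ofReal (Real.exp (lam * |u| ^ p
          - (P u + ∑ y ∈ G.neighborFinset x, W u (ω y)))) ≤
        ENNReal.ofReal (Real.exp (C * (1 + edgeMass G θ x)
          + ∑ y ∈ G.neighborFinset x, κ / (G.degree x * G.degree y) * |ω y| ^ p)) *
        ∫⁻ u, ENNReal.ofReal (Real.exp (-(P u + ∑ y ∈ G.neighborFinset x, W u (ω y)))) := by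
  have hrθ : 0 < r / θ := div_pos hr hθ
  have hp0 : 0 < p := by linarith [hp.1]
  have hq0 : 0 < q := hp0.trans hp.2
  obtain ⟨c1, hc1, h1⟩ := exists_weighted_young hr hθ hp.1 one_pos (half_pos hJW)
  obtain ⟨c2, hc2, h2⟩ := exists_weighted_young hr hθ hp.1 hκ hJW
  set K1 : ℝ := (lam + 1) * ((lam + 1) / (aV / 2)) ^ (p / (q - p))
  have hK1 : ∀ t : ℝ, 0 ≤ t → (lam + 1) * t ^ p ≤ aV / 2 * t ^ q + K1 := fun t ht =>
    mul_rpow_le_mul_rpow_add hp0 hp.2 (half_pos haV) (by linarith) ht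
  have hfin := lintegral_exp_sub_mul_abs_rpow_lt_top hq0 (half_pos haV) K1
  set K2 := ∫⁻ u : ℝ, ENNReal.ofReal (Real.exp (K1 - aV / 2 * |u| ^ q))
  have hK2 : K2 ≤ ENNReal.ofReal (Real.exp K2.toReal) := by
    rw [← ENNReal.ofReal_toReal hfin.ne]
    apply ENNReal.ofReal_le_ofReal
    rw [ENNReal.toReal_ofReal ENNReal.toReal_nonneg]
    linarith [Real.add_one_le_exp K2.toReal]
  obtain ⟨Pm, hPm⟩ := (isCompact_Icc (a := (0 : ℝ)) (b := 1)).exists_bound_of_continuousOn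
    hPcont.continuousOn
  have hPm0 : 0 ≤ Pm := (norm_nonneg _).trans (hPm 0 (by simp))
  have hK20 : 0 ≤ K2.toReal := ENNReal.toReal_nonneg
  refine ⟨cV + K2.toReal + Pm + IW + JW / 2 + c1 + c2, by positivity, fun x ω => ?_⟩
  set n : ℝ := (G.degree x : ℝ)
  set m := edgeMass G θ x
  have hn0 : 0 ≤ n := by positivity
  have hnm : n ≤ m := degree_le_edgeMass G hθ x
  have hnm' : n ^ (1 + θ) ≤ m := degree_rpow_le_edgeMass G hθ x
  have hm0 : 0 ≤ m := edgeMass_nonneg G θ x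
  set T := ∑ y ∈ G.neighborFinset x, JW * |ω y| ^ r
  set B := ∑ y ∈ G.neighborFinset x, κ / (n * G.degree y) * |ω y| ^ p
  have hT : T ≤ B + c2 * m := by
    simp only [T, B, m, edgeMass]
    rw [Finset.mul_sum, ← Finset.sum_add_distrib]
    refine Finset.sum_le_sum fun y hy => ?_
    have hadj := (G.mem_neighborFinset x y).1 hy
    have hN : 1 ≤ n * (G.degree y : ℝ) := by
      have e1 : 1 ≤ n := one_le_degree_of_adj G hadj
      have e2 := one_le_degree_of_adj G hadj.symm
      nlinarith
    have hN0 : 0 < n * (G.degree y : ℝ) := by linarith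
    have h := h2 _ |ω y| hN (abs_nonneg _)
    rw [rpow_add hN0, rpow_one] at h
    refine le_of_mul_le_mul_left (h.trans (le_of_eq ?_)) hN0
    rw [mul_add, ← mul_assoc (n * (G.degree y : ℝ)) (κ / _), mul_div_cancel₀ _ hN0.ne']
    ring
  have hS := abs_sum_interaction_le G hW x ω
  have hupper : ∀ u : ℝ, lam * |u| ^ p - (P u + ∑ y ∈ G.neighborFinset x, W u (ω y)) ≤
      (cV + n * IW / 2 + c1 * m + T / 2) + (K1 - aV / 2 * |u| ^ q) := by
    intro u
    have e1 := (abs_le.1 (hS u)).1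
    have e2 := hP u
    have e3 := hK1 |u| (abs_nonneg u)
    have e5 : 0 ≤ |u| ^ p := rpow_nonneg (abs_nonneg u) p
    have e4 : n * (JW / 2 * |u| ^ r) ≤ 1 * |u| ^ p + c1 * m := by
      rcases Nat.eq_zero_or_pos (G.degree x) with h | h
      · have : n = 0 := by simp [n, h]
        rw [this]
        nlinarith [mul_nonneg hc1 hm0]
      · refine (h1 n |u| (Nat.one_le_cast.2 h) (abs_nonneg u)).trans ?_
        gcongr
    linarith
  have hlower : ∀ u ∈ Set.Icc (0 : ℝ) 1, -(Pm + (n * IW + n * JW + T) / 2) ≤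
      -(P u + ∑ y ∈ G.neighborFinset x, W u (ω y)) := by
    intro u hu
    have e1 := (abs_le.1 (hS u)).2
    have e2 := (abs_le.1 (hPm u hu)).2
    have e3 : |u| ^ r ≤ 1 := rpow_le_one (abs_nonneg u) (by rw [abs_of_nonneg hu.1]; exact hu.2) hr.le
    have e4 : n * JW * |u| ^ r ≤ n * JW * 1 := by gcongr
    linarith
  calc ∫⁻ u, ENNReal.ofReal (Real.exp (lam * |u| ^ p
          - (P u + ∑ y ∈ G.neighborFinset x, W u (ω y))))
      ≤ ∫⁻ u, ENNReal.ofReal (Real.exp (cV + n * IW / 2 + c1 * m + T / 2))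
          * ENNReal.ofReal (Real.exp (K1 - aV / 2 * |u| ^ q)) := by
        refine lintegral_mono fun u => ?_
        rw [← ENNReal.ofReal_mul (Real.exp_nonneg _), ← Real.exp_add]
        exact ENNReal.ofReal_le_ofReal (Real.exp_le_exp.2 (hupper u))
    _ = ENNReal.ofReal (Real.exp (cV + n * IW / 2 + c1 * m + T / 2)) * K2 :=
        lintegral_const_mul' _ _ ENNReal.ofReal_ne_top
    _ ≤ ENNReal.ofReal (Real.exp (cV + n * IW / 2 + c1 * m + T / 2))
          * ENNReal.ofReal (Real.exp K2.toReal) := by gcongr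
    _ ≤ ENNReal.ofReal (Real.exp ((cV + K2.toReal + Pm + IW + JW / 2 + c1 + c2) * (1 + m) + B))
          * ENNReal.ofReal (Real.exp (-(Pm + (n * IW + n * JW + T) / 2))) := by
        rw [← ENNReal.ofReal_mul (Real.exp_nonneg _), ← Real.exp_add,
          ← ENNReal.ofReal_mul (Real.exp_nonneg _), ← Real.exp_add]
        refine ENNReal.ofReal_le_ofReal (Real.exp_le_exp.2 ?_)
        have e1 : n * IW ≤ m * IW := by gcongr
        have e2 : n * JW ≤ m * JW := by gcongr
        have e3 : 0 ≤ (cV + K2.toReal + Pm) * m := by positivity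
        nlinarith
    _ ≤ _ := by
        gcongr
        calc ENNReal.ofReal (Real.exp (-(Pm + (n * IW + n * JW + T) / 2)))
            = ∫⁻ _u in Set.Icc (0 : ℝ) 1,
                ENNReal.ofReal (Real.exp (-(Pm + (n * IW + n * JW + T) / 2))) := by simp
          _ ≤ ∫⁻ u in Set.Icc (0 : ℝ) 1, ENNReal.ofReal
                (Real.exp (-(P u + ∑ y ∈ G.neighborFinset x, W u (ω y)))) :=
              setLIntegral_mono' measurableSet_Icc fun u hu =>
                ENNReal.ofReal_le_ofReal (Real.exp_le_exp.2 (hlower u hu))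
          _ ≤ _ := setLIntegral_le_lintegral _ _

/-- Separation of the contribution of a single spin from the local Hamiltonian. -/
theorem exists_ham_update_eq (G : SimpleGraph V) [∀ v : V, Fintype (G.neighborSet v)]
    {W : ℝ → ℝ → ℝ} (hWsym : ∀ u v : ℝ, W u v = W v u) (P : ℝ → ℝ) {Λ : Finset V} {x : V}
    (hx : x ∈ Λ) (ω : V → ℝ) :
    ∃ R : ℝ, ∀ u : ℝ, ham G W P Λ (Function.update ω x u) =
      R + (P u + ∑ y ∈ G.neighborFinset x, W u (ω y)) := by
  have key : ∀ η : V → ℝ, ham G W P Λ η =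
      ((∑ z ∈ Λ.erase x, ∑ y ∈ (G.neighborFinset z ∩ Λ).erase x, W (η z) (η y)) / 2
        + ∑ z ∈ Λ.erase x, ∑ y ∈ G.neighborFinset z \ Λ, W (η z) (η y)
        + ∑ z ∈ Λ.erase x, P (η z))
      + (P (η x) + ∑ y ∈ G.neighborFinset x, W (η x) (η y)) := by
    intro η
    have h1 : ∑ z ∈ Λ.erase x, ∑ y ∈ G.neighborFinset z ∩ Λ, W (η z) (η y) =
        ∑ z ∈ Λ.erase x, ∑ y ∈ (G.neighborFinset z ∩ Λ).erase x, W (η z) (η y)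
        + ∑ y ∈ G.neighborFinset x ∩ Λ, W (η x) (η y) := by
      have h2 : ∑ y ∈ G.neighborFinset x ∩ Λ, W (η x) (η y) =
          ∑ z ∈ Λ.erase x, if x ∈ G.neighborFinset z then W (η z) (η x) else 0 := by
        rw [← Finset.sum_filter]
        refine Finset.sum_congr ?_ fun z _ => hWsym _ _
        ext z
        simp only [Finset.mem_inter, SimpleGraph.mem_neighborFinset, Finset.mem_filter,
          Finset.mem_erase]
        constructor
        · rintro ⟨h, hz⟩
          exact ⟨⟨h.ne', hz⟩, h.symm⟩
        · rintro ⟨⟨_, hz⟩, h⟩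
          exact ⟨h.symm, hz⟩
      rw [h2, ← Finset.sum_add_distrib]
      refine Finset.sum_congr rfl fun z _ => ?_
      split_ifs with h
      · rw [Finset.sum_erase_add _ _ (Finset.mem_inter.2 ⟨h, hx⟩)]
      · rw [Finset.erase_eq_of_notMem (fun h' => h (Finset.mem_inter.1 h').1), add_zero]
    have h3 : ∑ y ∈ G.neighborFinset x, W (η x) (η y) =
        ∑ y ∈ G.neighborFinset x ∩ Λ, W (η x) (η y)
        + ∑ y ∈ G.neighborFinset x \ Λ, W (η x) (η y) :=
      (Finset.sum_inter_add_sum_sdiff _ _ _).symm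
    unfold ham
    rw [← Finset.sum_erase_add Λ (fun z => ∑ y ∈ G.neighborFinset z ∩ Λ, W (η z) (η y)) hx,
      ← Finset.sum_erase_add Λ (fun z => ∑ y ∈ G.neighborFinset z \ Λ, W (η z) (η y)) hx,
      ← Finset.sum_erase_add Λ (fun z => P (η z)) hx, h1, h3]
    ring
  refine ⟨(∑ z ∈ Λ.erase x, ∑ y ∈ (G.neighborFinset z ∩ Λ).erase x, W (ω z) (ω y)) / 2
        + ∑ z ∈ Λ.erase x, ∑ y ∈ G.neighborFinset z \ Λ, W (ω z) (ω y)
        + ∑ z ∈ Λ.erase x, P (ω z), fun u => ?_⟩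
  have hne : ∀ y, y ≠ x → Function.update ω x u y = ω y := fun y hy =>
    Function.update_of_ne hy _ _
  have hz : ∀ z ∈ Λ.erase x, Function.update ω x u z = ω z := fun z h =>
    hne z (Finset.ne_of_mem_erase h)
  have hout : ∀ z, ∀ y ∈ G.neighborFinset z \ Λ, Function.update ω x u y = ω y := fun z y h =>
    hne y fun h' => (Finset.mem_sdiff.1 h).2 (h' ▸ hx)
  rw [key, Function.update_self]
  congr 1
  · congr 1
    · congr 1
      · congr 1
        refine Finset.sum_congr rfl fun z h => Finset.sum_congr rfl fun y h' => ?_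
        rw [hz z h, hne y (Finset.ne_of_mem_erase h')]
      · refine Finset.sum_congr rfl fun z h => Finset.sum_congr rfl fun y h' => ?_
        rw [hz z h, hout z y h']
    · exact Finset.sum_congr rfl fun z h => by rw [hz z h]
  · congr 1
    refine Finset.sum_congr rfl fun y h => ?_
    rw [hne y ((G.mem_neighborFinset x y).1 h).ne']

/-- The local Hamiltonian is bounded below by a one-body term. -/
theorem exists_le_ham (G : SimpleGraph V) [∀ v : V, Fintype (G.neighborSet v)]
    {W : ℝ → ℝ → ℝ} {IW JW r : ℝ} (hJW : 0 < JW)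
    (hW : ∀ u v : ℝ, |W u v| ≤ (IW + JW * (|u| ^ r + |v| ^ r)) / 2) (P : ℝ → ℝ)
    (Λ : Finset V) (ξ : V → ℝ) :
    ∃ A B : ℝ, 0 ≤ B ∧ ∀ σ : ↥Λ → ℝ,
      ∑ z : ↥Λ, P (σ z) - A - B * ∑ z : ↥Λ, |σ z| ^ r ≤ ham G W P Λ (comb Λ σ ξ) := by
  set N1 : ℝ := ∑ x ∈ Λ, ∑ y ∈ G.neighborFinset x ∩ Λ, (IW + JW * |ξ y| ^ r) / 2
  set N2 : ℝ := ∑ x ∈ Λ, ∑ y ∈ G.neighborFinset x \ Λ, (IW + JW * |ξ y| ^ r) / 2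
  set M1 : ℝ := ∑ x ∈ Λ, ∑ y ∈ G.neighborFinset x ∩ Λ, JW
  set M2 : ℝ := ∑ x ∈ Λ, ∑ y ∈ G.neighborFinset x \ Λ, JW
  have hM1 : 0 ≤ M1 := Finset.sum_nonneg fun _ _ => Finset.sum_nonneg fun _ _ => hJW.le
  have hM2 : 0 ≤ M2 := Finset.sum_nonneg fun _ _ => Finset.sum_nonneg fun _ _ => hJW.le
  refine ⟨N1 / 2 + N2, M1 / 2 + M2, by positivity, fun σ => ?_⟩
  set T : ℝ := ∑ z : ↥Λ, |σ z| ^ r with hT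
  set ω := comb Λ σ ξ with hω
  have hin : ∀ z (hz : z ∈ Λ), ω z = σ ⟨z, hz⟩ := fun z hz => by simp [hω, comb, hz]
  have hTle : ∀ z ∈ Λ, |ω z| ^ r ≤ T := fun z hz => by
    rw [hin z hz]
    exact Finset.single_le_sum (f := fun z : ↥Λ => |σ z| ^ r)
      (fun _ _ => rpow_nonneg (abs_nonneg _) _) (Finset.mem_univ _)
  have hT0 : 0 ≤ T := Finset.sum_nonneg fun _ _ => rpow_nonneg (abs_nonneg _) _
  have hTle' : ∀ y, |ω y| ^ r ≤ T + |ξ y| ^ r := fun y => by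
    have h0 : 0 ≤ |ξ y| ^ r := rpow_nonneg (abs_nonneg _) _
    by_cases hy : y ∈ Λ
    · linarith [hTle y hy]
    · have : ω y = ξ y := by simp [hω, comb, hy]
      rw [this]; linarith
  have hpair : ∀ x ∈ Λ, ∀ y, -((IW + JW * |ξ y| ^ r) / 2 + JW * T) ≤ W (ω x) (ω y) := by
    intro x hx y
    have e1 := (abs_le.1 (hW (ω x) (ω y))).1
    have e2 := mul_le_mul_of_nonneg_left (add_le_add (hTle x hx) (hTle' y)) hJW.le
    linarith
  have hsum : ∀ s : V → Finset V, -(∑ x ∈ Λ, ∑ y ∈ s x, (IW + JW * |ξ y| ^ r) / 2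
      + (∑ x ∈ Λ, ∑ y ∈ s x, JW) * T) ≤ ∑ x ∈ Λ, ∑ y ∈ s x, W (ω x) (ω y) := by
    intro s
    simp only [Finset.sum_mul]
    rw [← Finset.sum_add_distrib, ← Finset.sum_neg_distrib]
    refine Finset.sum_le_sum fun x hx => ?_
    rw [← Finset.sum_add_distrib, ← Finset.sum_neg_distrib]
    exact Finset.sum_le_sum fun y _ => hpair x hx y
  have h1 := hsum fun x => G.neighborFinset x ∩ Λ
  have h2 := hsum fun x => G.neighborFinset x \ Λ
  have h3 : ∑ x ∈ Λ, P (ω x) = ∑ z : ↥Λ, P (σ z) := by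
    rw [← Finset.sum_coe_sort Λ]
    exact Finset.sum_congr rfl fun z _ => by rw [hin z.1 z.2]
  unfold ham
  rw [h3]
  simp only [N1, N2, M1, M2]
  linarith

theorem continuous_comb (Λ : Finset V) (ξ : V → ℝ) :
    Continuous fun σ : ↥Λ → ℝ => comb Λ σ ξ := by
  refine continuous_pi fun x => ?_
  unfold comb
  split_ifs with h
  · exact continuous_apply _
  · exact continuous_const

theorem comb_update (Λ : Finset V) (ξ : V → ℝ) (σ : ↥Λ → ℝ) (x : ↥Λ) (u : ℝ) :
    comb Λ (Function.update σ x u) ξ = Function.update (comb Λ σ ξ) x u := by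
  ext y
  by_cases hy : y = x
  · subst hy; simp [comb]
  · rw [Function.update_of_ne hy]
    unfold comb
    split_ifs with h
    · rw [Function.update_of_ne]
      exact fun h' => hy (congrArg Subtype.val h')
    · rfl

theorem continuous_ham (G : SimpleGraph V) [∀ v : V, Fintype (G.neighborSet v)]
    {W : ℝ → ℝ → ℝ} (hWcont : Continuous (Function.uncurry W))
    {P : ℝ → ℝ} (hPcont : Continuous P) (Λ : Finset V) : Continuous (ham G W P Λ) := by
  have hW' : ∀ x y : V, Continuous fun ω : V → ℝ => W (ω x) (ω y) := fun x y =>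
    hWcont.comp (f := fun ω : V → ℝ => (ω x, ω y))
      ((continuous_apply x).prodMk (continuous_apply y))
  have hP' : ∀ x : V, Continuous fun ω : V → ℝ => P (ω x) := fun x =>
    hPcont.comp (continuous_apply x)
  unfold ham
  fun_prop

/-- Exponential integrability of the local Gibbs weight. -/
theorem lintegral_exp_sum_sub_ham_lt_top (G : SimpleGraph V)
    [∀ v : V, Fintype (G.neighborSet v)]
    {W : ℝ → ℝ → ℝ} {IW JW r : ℝ} (hJW : 0 < JW) (hr : 0 < r)
    (hW : ∀ u v : ℝ, |W u v| ≤ (IW + JW * (|u| ^ r + |v| ^ r)) / 2)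
    {P : ℝ → ℝ} {aV cV q : ℝ} (haV : 0 < aV)
    (hP : ∀ u : ℝ, aV * |u| ^ q - cV ≤ P u)
    {lam p : ℝ} (hlam : 0 ≤ lam) (hp : 0 < p) (hpq : p < q) (hrq : r < q)
    (Λ : Finset V) (ξ : V → ℝ) :
    ∫⁻ σ : ↥Λ → ℝ, ENNReal.ofReal (Real.exp (lam * ∑ z : ↥Λ, |σ z| ^ p
      - ham G W P Λ (comb Λ σ ξ))) < ⊤ := by
  obtain ⟨A, B, hB, hAB⟩ := exists_le_ham G hJW hW P Λ ξ
  have ha3 : 0 < aV / 3 := by positivity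
  set K1 := lam * (lam / (aV / 3)) ^ (p / (q - p))
  set K2 := B * (B / (aV / 3)) ^ (r / (q - r))
  have h1 : ∀ u : ℝ, lam * |u| ^ p + B * |u| ^ r - P u ≤ (cV + K1 + K2) - aV / 3 * |u| ^ q := by
    intro u
    have e1 := mul_rpow_le_mul_rpow_add hp hpq ha3 hlam (abs_nonneg u)
    have e2 := mul_rpow_le_mul_rpow_add hr hrq ha3 hB (abs_nonneg u)
    have e3 := hP u
    simp only [K1, K2]
    linarith
  have hExpInt : Integrable fun σ : ↥Λ → ℝ =>
      ∏ z : ↥Λ, Real.exp (cV + K1 + K2) * Real.exp (-(aV / 3) * |σ z| ^ q) :=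
    Integrable.fintype_prod fun _ =>
      (integrable_exp_neg_mul_abs_rpow (hr.trans hrq) ha3).const_mul _
  refine lt_of_le_of_lt (lintegral_mono fun σ => ?_) (hExpInt.const_mul (Real.exp A)).lintegral_lt_top
  refine ENNReal.ofReal_le_ofReal ?_
  simp only [← Real.exp_add, ← Real.exp_sum]
  refine Real.exp_le_exp.2 ?_
  have h2 : ∑ z : ↥Λ, (lam * |σ z| ^ p + B * |σ z| ^ r - P (σ z)) ≤
      ∑ z : ↥Λ, (cV + K1 + K2 + -(aV / 3) * |σ z| ^ q) :=
    Finset.sum_le_sum fun z _ => (h1 (σ z)).trans (le_of_eq (by ring))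
  rw [Finset.sum_sub_distrib, Finset.sum_add_distrib, ← Finset.mul_sum, ← Finset.mul_sum] at h2
  linarith [hAB σ]

/-- The local Gibbs distribution of the spins in `Λ`. -/
def gibbsSpin (G : SimpleGraph V) [∀ v : V, Fintype (G.neighborSet v)]
    (W : ℝ → ℝ → ℝ) (P : ℝ → ℝ) (Λ : Finset V) (ξ : V → ℝ) : Measure (↥Λ → ℝ) :=
  (ENNReal.ofReal (partZ G W P Λ ξ))⁻¹ • (volume : Measure (↥Λ → ℝ)).withDensity
    fun σ => ENNReal.ofReal (Real.exp (- ham G W P Λ (comb Λ σ ξ)))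

theorem lintegral_gibbsKer (G : SimpleGraph V) [∀ v : V, Fintype (G.neighborSet v)]
    (W : ℝ → ℝ → ℝ) (P : ℝ → ℝ) (Λ : Finset V) (ξ : V → ℝ) {f : (V → ℝ) → ENNReal}
    (hf : Measurable f) :
    ∫⁻ ω, f ω ∂(gibbsKer G W P Λ ξ) = ∫⁻ σ, f (comb Λ σ ξ) ∂(gibbsSpin G W P Λ ξ) := by
  unfold gibbsKer gibbsSpin
  rw [lintegral_smul_measure, lintegral_smul_measure,
    lintegral_map hf (continuous_comb Λ ξ).measurable]

theorem measurable_exp_neg_ham (G : SimpleGraph V) [∀ v : V, Fintype (G.neighborSet v)]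
    {W : ℝ → ℝ → ℝ} (hWcont : Continuous (Function.uncurry W))
    {P : ℝ → ℝ} (hPcont : Continuous P) (Λ : Finset V) (ξ : V → ℝ) :
    Measurable fun σ : ↥Λ → ℝ => Real.exp (- ham G W P Λ (comb Λ σ ξ)) :=
  (Real.continuous_exp.comp
    ((continuous_ham G hWcont hPcont Λ).comp (continuous_comb Λ ξ)).neg).measurable

theorem lintegral_gibbsSpin (G : SimpleGraph V) [∀ v : V, Fintype (G.neighborSet v)]
    {W : ℝ → ℝ → ℝ} (hWcont : Continuous (Function.uncurry W))
    {P : ℝ → ℝ} (hPcont : Continuous P) (Λ : Finset V) (ξ : V → ℝ) {f : (↥Λ → ℝ) → ENNReal}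
    (hf : Measurable f) :
    ∫⁻ σ, f σ ∂(gibbsSpin G W P Λ ξ) = (ENNReal.ofReal (partZ G W P Λ ξ))⁻¹ *
      ∫⁻ σ, ENNReal.ofReal (Real.exp (- ham G W P Λ (comb Λ σ ξ))) * f σ := by
  unfold gibbsSpin
  rw [lintegral_smul_measure, lintegral_withDensity_eq_lintegral_mul _
    (measurable_exp_neg_ham G hWcont hPcont Λ ξ).ennreal_ofReal hf]
  rfl

theorem measurable_exp_abs_rpow {ι : Type*} (c p : ℝ) (x : ι) :
    Measurable fun ω : ι → ℝ => ENNReal.ofReal (Real.exp (c * |ω x| ^ p)) := by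
  fun_prop

/-- The one-point estimate integrated against the local Gibbs distribution. -/
theorem lintegral_exp_gibbsSpin_le (G : SimpleGraph V) [∀ v : V, Fintype (G.neighborSet v)]
    {W : ℝ → ℝ → ℝ} (hWcont : Continuous (Function.uncurry W))
    (hWsym : ∀ u v : ℝ, W u v = W v u) {P : ℝ → ℝ} (hPcont : Continuous P)
    {lam p c : ℝ} (k : V → ℝ) (Λ : Finset V) (ξ : V → ℝ) {x : V} (hx : x ∈ Λ)
    (hbound : ∀ ω : V → ℝ,
      ∫⁻ u, ENNReal.ofReal (Real.exp (lam * |u| ^ p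
          - (P u + ∑ y ∈ G.neighborFinset x, W u (ω y)))) ≤
        ENNReal.ofReal (Real.exp (c + ∑ y ∈ G.neighborFinset x, k y * |ω y| ^ p)) *
        ∫⁻ u, ENNReal.ofReal (Real.exp (-(P u + ∑ y ∈ G.neighborFinset x, W u (ω y))))) :
    ∫⁻ σ, ENNReal.ofReal (Real.exp (lam * |comb Λ σ ξ x| ^ p)) ∂(gibbsSpin G W P Λ ξ) ≤
      ∫⁻ σ, ENNReal.ofReal (Real.exp
        (c + ∑ y ∈ G.neighborFinset x, k y * |comb Λ σ ξ y| ^ p)) ∂(gibbsSpin G W P Λ ξ) := by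
  have hcomb : ∀ y, Measurable fun σ : ↥Λ → ℝ => comb Λ σ ξ y := fun y =>
    (measurable_pi_apply y).comp (continuous_comb Λ ξ).measurable
  have hm1 : Measurable fun σ : ↥Λ → ℝ =>
      ENNReal.ofReal (Real.exp (lam * |comb Λ σ ξ x| ^ p)) := by fun_prop
  have hm2 : Measurable fun σ : ↥Λ → ℝ => ENNReal.ofReal (Real.exp
      (c + ∑ y ∈ G.neighborFinset x, k y * |comb Λ σ ξ y| ^ p)) := by fun_prop
  have hm0 := (measurable_exp_neg_ham G hWcont hPcont Λ ξ).ennreal_ofReal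
  rw [lintegral_gibbsSpin G hWcont hPcont Λ ξ hm1, lintegral_gibbsSpin G hWcont hPcont Λ ξ hm2]
  refine mul_le_mul_right ?_ _
  rw [volume_pi]
  refine lintegral_le_of_lmarginal_le {(⟨x, hx⟩ : ↥Λ)} (hm0.mul hm1) (hm0.mul hm2) ?_
  rw [lmarginal_singleton, lmarginal_singleton]
  intro σ
  obtain ⟨R, hR⟩ := exists_ham_update_eq G hWsym P hx (comb Λ σ ξ)
  simp only [comb_update]
  generalize comb Λ σ ξ = ω at hR ⊢
  have hB : ∀ u : ℝ, ∑ y ∈ G.neighborFinset x, k y * |Function.update ω x u y| ^ p =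
      ∑ y ∈ G.neighborFinset x, k y * |ω y| ^ p := fun u =>
    Finset.sum_congr rfl fun y hy => by
      rw [Function.update_of_ne ((G.mem_neighborFinset x y).1 hy).ne']
  simp only [hR, hB, Function.update_self]
  calc ∫⁻ u, ENNReal.ofReal (Real.exp (-(R + (P u + ∑ y ∈ G.neighborFinset x, W u (ω y)))))
          * ENNReal.ofReal (Real.exp (lam * |u| ^ p))
      = ∫⁻ u, ENNReal.ofReal (Real.exp (-R)) * ENNReal.ofReal (Real.exp (lam * |u| ^ p
          - (P u + ∑ y ∈ G.neighborFinset x, W u (ω y)))) := by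
        refine lintegral_congr fun u => ?_
        rw [← ENNReal.ofReal_mul (Real.exp_nonneg _), ← Real.exp_add,
          ← ENNReal.ofReal_mul (Real.exp_nonneg _), ← Real.exp_add]
        congr 2; ring
    _ ≤ ENNReal.ofReal (Real.exp (-R)) * (ENNReal.ofReal (Real.exp (c
          + ∑ y ∈ G.neighborFinset x, k y * |ω y| ^ p)) *
        ∫⁻ u, ENNReal.ofReal (Real.exp (-(P u + ∑ y ∈ G.neighborFinset x, W u (ω y))))) := by
        rw [lintegral_const_mul' _ _ ENNReal.ofReal_ne_top]
        exact mul_le_mul_right (hbound ω) _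
    _ = _ := by
        rw [← lintegral_const_mul' _ _ ENNReal.ofReal_ne_top,
          ← lintegral_const_mul' _ _ ENNReal.ofReal_ne_top]
        refine lintegral_congr fun u => ?_
        simp only [← ENNReal.ofReal_mul (Real.exp_nonneg _), ← Real.exp_add]
        congr 2; ring

theorem ofReal_exp_rpow (a s : ℝ) :
    ENNReal.ofReal (Real.exp a) ^ s = ENNReal.ofReal (Real.exp (a * s)) := by
  rw [ENNReal.ofReal_rpow_of_pos (Real.exp_pos a), ← Real.exp_mul]

theorem prod_ofReal_exp {ι : Type*} (s : Finset ι) (f : ι → ℝ) :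
    ∏ i ∈ s, ENNReal.ofReal (Real.exp (f i)) = ENNReal.ofReal (Real.exp (∑ i ∈ s, f i)) := by
  rw [Real.exp_sum, ENNReal.ofReal_prod_of_nonneg fun i _ => Real.exp_nonneg _]

/-- Hölder's inequality for exponential moments under a probability measure. -/
theorem lintegral_exp_sum_le {Ω' ι : Type*} [MeasurableSpace Ω'] (ν : Measure Ω')
    [IsProbabilityMeasure ν] (s : Finset ι) (g : ι → Ω' → ℝ)
    (hg : ∀ i, Measurable (g i)) (k M : ι → ℝ) (hk : ∀ i ∈ s, 0 ≤ k i) (hk1 : ∑ i ∈ s, k i ≤ 1)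
    (hM : ∀ i ∈ s, ∫⁻ a, ENNReal.ofReal (Real.exp (g i a)) ∂ν = ENNReal.ofReal (Real.exp (M i))) :
    ∫⁻ a, ENNReal.ofReal (Real.exp (∑ i ∈ s, k i * g i a)) ∂ν ≤
      ENNReal.ofReal (Real.exp (∑ i ∈ s, k i * M i)) := by
  have h := ENNReal.lintegral_mul_prod_norm_pow_le (μ := ν) s (g := fun _ => 1)
    (f := fun i a => ENNReal.ofReal (Real.exp (g i a))) (p := k) aemeasurable_const
    (fun i _ => ((hg i).exp.ennreal_ofReal).aemeasurable) (1 - ∑ i ∈ s, k i) (by ring)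
    (by linarith) hk
  rw [Finset.prod_congr rfl fun i hi => by rw [hM i hi]] at h
  simp only [ofReal_exp_rpow, prod_ofReal_exp, lintegral_const, measure_univ, mul_one,
    ENNReal.one_rpow, one_mul] at h
  simpa only [mul_comm (k _)] using h

/-- The logarithmic exponential moments of a local Gibbs distribution solve a linear system
of inequalities. -/
theorem exists_log_moment_system (G : SimpleGraph V) [∀ v : V, Fintype (G.neighborSet v)]
    {θ : ℝ} (hθ : 0 < θ) {W : ℝ → ℝ → ℝ} (hWcont : Continuous (Function.uncurry W))
    (hWsym : ∀ u v : ℝ, W u v = W v u) {IW JW r : ℝ} (hIW : 0 < IW) (hJW : 0 < JW) (hr : 0 < r)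
    (hW : ∀ u v : ℝ, |W u v| ≤ (IW + JW * (|u| ^ r + |v| ^ r)) / 2)
    {P : ℝ → ℝ} (hPcont : Continuous P) {aV cV q : ℝ} (haV : 0 < aV) (hcV : 0 < cV)
    (hP : ∀ u : ℝ, aV * |u| ^ q - cV ≤ P u)
    {lam p κ : ℝ} (hlam : 0 < lam) (hp : p ∈ Set.Ico (r + r / θ) q) (hκ : 0 < κ)
    (hκlam : κ ≤ lam) :
    ∃ C : ℝ, 0 ≤ C ∧ ∀ (Λ : Finset V) (ξ : V → ℝ), ∃ M : V → ℝ,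
      (∀ x ∈ Λ, 0 ≤ M x) ∧
      (∀ x ∈ Λ, ∫⁻ ω, ENNReal.ofReal (Real.exp (lam * |ω x| ^ p)) ∂(gibbsKer G W P Λ ξ) =
        ENNReal.ofReal (Real.exp (M x))) ∧
      ∀ x ∈ Λ, M x ≤ C * (1 + edgeMass G θ x) + ∑ y ∈ G.neighborFinset x,
        κ / (G.degree x * G.degree y) * (if y ∈ Λ then M y / lam else |ξ y| ^ p) := by
  have hrθ : 0 < r / θ := div_pos hr hθ
  have hp0 : 0 < p := by linarith [hp.1]
  have hrq : r < q := by linarith [hp.1, hp.2]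
  obtain ⟨C, hC, hbound⟩ := exists_single_site_bound G hθ hIW hJW hr hW hPcont haV hcV hP hlam hp hκ
  refine ⟨C, hC, fun Λ ξ => ?_⟩
  have hm0 := measurable_exp_neg_ham G hWcont hPcont Λ ξ
  have hZfin : ∫⁻ σ : ↥Λ → ℝ, ENNReal.ofReal (Real.exp (- ham G W P Λ (comb Λ σ ξ))) < ⊤ := by
    simpa using lintegral_exp_sum_sub_ham_lt_top G hJW hr hW haV hP le_rfl hp0 hp.2 hrq Λ ξ
  have hExpInt : Integrable fun σ : ↥Λ → ℝ => Real.exp (- ham G W P Λ (comb Λ σ ξ)) :=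
    (lintegral_ofReal_ne_top_iff_integrable hm0.aestronglyMeasurable
      (Filter.Eventually.of_forall fun _ => Real.exp_nonneg _)).1 hZfin.ne
  have hZpos : 0 < partZ G W P Λ ξ := integral_exp_pos hExpInt
  have hZ : ENNReal.ofReal (partZ G W P Λ ξ) =
      ∫⁻ σ : ↥Λ → ℝ, ENNReal.ofReal (Real.exp (- ham G W P Λ (comb Λ σ ξ))) :=
    ofReal_integral_eq_lintegral_ofReal hExpInt
      (Filter.Eventually.of_forall fun _ => Real.exp_nonneg _)
  have hZ0 : ENNReal.ofReal (partZ G W P Λ ξ) ≠ 0 := (ENNReal.ofReal_pos.2 hZpos).ne'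
  set ν := gibbsSpin G W P Λ ξ with hν
  have hprob : IsProbabilityMeasure ν := ⟨by
    have h := lintegral_gibbsSpin G hWcont hPcont Λ ξ (f := fun _ => 1) measurable_const
    simp only [lintegral_const, one_mul, mul_one, ← hZ] at h
    rw [h, ENNReal.inv_mul_cancel hZ0 ENNReal.ofReal_ne_top]⟩
  have hcomb : ∀ y, Measurable fun σ : ↥Λ → ℝ => comb Λ σ ξ y := fun y =>
    (measurable_pi_apply y).comp (continuous_comb Λ ξ).measurable
  set g : V → (↥Λ → ℝ) → ℝ := fun y σ => lam * |comb Λ σ ξ y| ^ p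
  have hg : ∀ y, Measurable (g y) := fun y => by
    have := hcomb y
    fun_prop
  have hg0 : ∀ y σ, 0 ≤ g y σ := fun y σ => mul_nonneg hlam.le (rpow_nonneg (abs_nonneg _) _)
  set E : V → ENNReal := fun y => ∫⁻ σ, ENNReal.ofReal (Real.exp (g y σ)) ∂ν with hE
  have hE1 : ∀ y, 1 ≤ E y := fun y => by
    calc (1 : ENNReal) = ∫⁻ _σ, 1 ∂ν := by simp
      _ ≤ E y := lintegral_mono fun σ => by
        rw [← ENNReal.ofReal_one]
        exact ENNReal.ofReal_le_ofReal (Real.one_le_exp (hg0 y σ))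
  have hEfin : ∀ y ∈ Λ, E y ≠ ⊤ := fun y hy => by
    rw [hE]
    simp only
    rw [hν, lintegral_gibbsSpin G hWcont hPcont Λ ξ (hg y).exp.ennreal_ofReal]
    refine ENNReal.mul_ne_top (ENNReal.inv_ne_top.2 hZ0) (ne_of_lt (lt_of_le_of_lt
      (lintegral_mono fun σ => ?_)
      (lintegral_exp_sum_sub_ham_lt_top G hJW hr hW haV hP hlam.le hp0 hp.2 hrq Λ ξ)))
    rw [← ENNReal.ofReal_mul (Real.exp_nonneg _), ← Real.exp_add]
    refine ENNReal.ofReal_le_ofReal (Real.exp_le_exp.2 ?_)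
    have h1 : |comb Λ σ ξ y| ^ p ≤ ∑ z : ↥Λ, |σ z| ^ p := by
      have : comb Λ σ ξ y = σ ⟨y, hy⟩ := by simp [comb, hy]
      rw [this]
      exact Finset.single_le_sum (f := fun z : ↥Λ => |σ z| ^ p)
        (fun _ _ => rpow_nonneg (abs_nonneg _) _) (Finset.mem_univ _)
    have h2 : g y σ ≤ lam * ∑ z : ↥Λ, |σ z| ^ p := mul_le_mul_of_nonneg_left h1 hlam.le
    linarith
  set M : V → ℝ := fun y => Real.log (E y).toReal
  have hEM : ∀ y ∈ Λ, E y = ENNReal.ofReal (Real.exp (M y)) := fun y hy => by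
    have h0 : 0 < (E y).toReal :=
      ENNReal.toReal_pos (one_pos.trans_le (hE1 y)).ne' (hEfin y hy)
    rw [Real.exp_log h0, ENNReal.ofReal_toReal (hEfin y hy)]
  refine ⟨M, fun y hy => ?_, fun y hy => ?_, fun x hx => ?_⟩
  · apply Real.log_nonneg
    have := ENNReal.toReal_mono (hEfin y hy) (hE1 y)
    simpa using this
  · rw [lintegral_gibbsKer G W P Λ ξ (measurable_exp_abs_rpow lam p y), ← hEM y hy]
  · set k : V → ℝ := fun y => κ / (G.degree x * G.degree y)
    have hk0 : ∀ y, 0 ≤ k y := fun y => by positivity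
    have h1 := lintegral_exp_gibbsSpin_le G hWcont hWsym hPcont k Λ ξ hx (hbound x)
    have hk1 : ∑ y ∈ G.neighborFinset x ∩ Λ, k y / lam ≤ 1 := by
      calc ∑ y ∈ G.neighborFinset x ∩ Λ, k y / lam ≤ ∑ y ∈ G.neighborFinset x, k y / lam :=
            Finset.sum_le_sum_of_subset_of_nonneg Finset.inter_subset_left
              fun y _ _ => div_nonneg (hk0 y) hlam.le
        _ ≤ ∑ _y ∈ G.neighborFinset x, 1 / (G.degree x : ℝ) := by
            refine Finset.sum_le_sum fun y hy => ?_
            have hadj := (G.mem_neighborFinset x y).1 hy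
            have e1 := one_le_degree_of_adj G hadj
            have e2 := one_le_degree_of_adj G hadj.symm
            simp only [k]
            rw [div_div, div_le_div_iff₀ (by positivity) (by positivity)]
            have e3 : κ * (G.degree x : ℝ) ≤ lam * G.degree x := by gcongr
            have e4 : lam * (G.degree x : ℝ) * 1 ≤ lam * G.degree x * G.degree y := by gcongr
            linarith
        _ ≤ 1 := by
            rw [Finset.sum_const, SimpleGraph.card_neighborFinset_eq_degree, nsmul_eq_mul,
              mul_one_div]
            exact div_self_le_one _
    have h2 := lintegral_exp_sum_le ν (G.neighborFinset x ∩ Λ) g hg (fun y => k y / lam) M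
      (fun y _ => div_nonneg (hk0 y) hlam.le) hk1
      (fun y hy => hEM y (Finset.mem_inter.1 hy).2)
    set c := C * (1 + edgeMass G θ x)
    set B := ∑ y ∈ G.neighborFinset x \ Λ, k y * |ξ y| ^ p
    have h3 : ∀ σ : ↥Λ → ℝ, c + ∑ y ∈ G.neighborFinset x, k y * |comb Λ σ ξ y| ^ p =
        (c + B) + ∑ y ∈ G.neighborFinset x ∩ Λ, k y / lam * g y σ := by
      intro σ
      rw [← Finset.sum_inter_add_sum_sdiff (G.neighborFinset x) Λ]
      have e1 : ∑ y ∈ G.neighborFinset x \ Λ, k y * |comb Λ σ ξ y| ^ p = B :=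
        Finset.sum_congr rfl fun y hy => by
          have : comb Λ σ ξ y = ξ y := by simp [comb, (Finset.mem_sdiff.1 hy).2]
          rw [this]
      have e2 : ∑ y ∈ G.neighborFinset x ∩ Λ, k y * |comb Λ σ ξ y| ^ p =
          ∑ y ∈ G.neighborFinset x ∩ Λ, k y / lam * g y σ :=
        Finset.sum_congr rfl fun y _ => by
          simp only [g]; field_simp
      rw [e1, e2]; ring
    have h4 : ENNReal.ofReal (Real.exp (M x)) ≤ ENNReal.ofReal (Real.exp
        ((c + B) + ∑ y ∈ G.neighborFinset x ∩ Λ, k y / lam * M y)) := by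
      rw [← hEM x hx]
      refine h1.trans ?_
      simp only [h3, Real.exp_add (c + B), ENNReal.ofReal_mul (Real.exp_nonneg (c + B))]
      rw [lintegral_const_mul' _ _ ENNReal.ofReal_ne_top]
      exact mul_le_mul_right h2 _
    have h5 := Real.exp_le_exp.1 ((ENNReal.ofReal_le_ofReal_iff (Real.exp_nonneg _)).1 h4)
    refine h5.trans (le_of_eq ?_)
    rw [← Finset.sum_inter_add_sum_sdiff (G.neighborFinset x) Λ]
    have e1 : ∑ y ∈ G.neighborFinset x \ Λ, k y * (if y ∈ Λ then M y / lam else |ξ y| ^ p) = B :=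
      Finset.sum_congr rfl fun y hy => by rw [if_neg (Finset.mem_sdiff.1 hy).2]
    have e2 : ∑ y ∈ G.neighborFinset x ∩ Λ, k y * (if y ∈ Λ then M y / lam else |ξ y| ^ p) =
        ∑ y ∈ G.neighborFinset x ∩ Λ, k y / lam * M y :=
      Finset.sum_congr rfl fun y hy => by
        rw [if_pos (Finset.mem_inter.1 hy).2]; ring
    rw [e1, e2]; ring

theorem sum_wgt_mul_sum_neighbor_le (G : SimpleGraph V) [∀ v : V, Fintype (G.neighborSet v)]
    (hconn : G.Connected) (o : V) (α : ℝ) {κ : ℝ} (hκ : 0 ≤ κ) (Λ : Finset V) {F : V → ℝ}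
    (hF : ∀ y, 0 ≤ F y) :
    ∑ x ∈ Λ, wgt G o α x * ∑ y ∈ G.neighborFinset x, κ / (G.degree x * G.degree y) * F y ≤
      κ * Real.exp |α| * ∑ y ∈ Λ.biUnion fun x => G.neighborFinset x, wgt G o α y * F y := by
  set e := Real.exp |α|
  have hw : ∀ y, 0 ≤ wgt G o α y := fun y => Real.exp_nonneg _
  have he : 0 ≤ e := Real.exp_nonneg _
  calc ∑ x ∈ Λ, wgt G o α x * ∑ y ∈ G.neighborFinset x, κ / (G.degree x * G.degree y) * F y
      ≤ ∑ x ∈ Λ, ∑ y ∈ G.neighborFinset x, κ * e * (wgt G o α y * F y) / G.degree y := by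
        refine Finset.sum_le_sum fun x _ => ?_
        rw [Finset.mul_sum]
        refine Finset.sum_le_sum fun y hy => ?_
        have hadj := (G.mem_neighborFinset x y).1 hy
        have e1 := one_le_degree_of_adj G hadj
        have e2 := one_le_degree_of_adj G hadj.symm
        have e3 := wgt_le_of_adj G hconn o α hadj
        have e4 : κ / (G.degree x * G.degree y) ≤ κ / G.degree y := by
          gcongr
          nlinarith
        calc wgt G o α x * (κ / (G.degree x * G.degree y) * F y)
            ≤ (e * wgt G o α y) * (κ / G.degree y * F y) :=
              mul_le_mul e3 (mul_le_mul_of_nonneg_right e4 (hF y))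
                (mul_nonneg (by positivity) (hF y)) (mul_nonneg he (hw y))
          _ = _ := by ring
    _ = ∑ y ∈ Λ.biUnion fun x => G.neighborFinset x,
          ∑ _x ∈ Λ ∩ G.neighborFinset y, κ * e * (wgt G o α y * F y) / G.degree y := by
        refine Finset.sum_comm' fun x y => ?_
        simp only [SimpleGraph.mem_neighborFinset, Finset.mem_inter, Finset.mem_biUnion]
        exact ⟨fun h => ⟨⟨h.1, h.2.symm⟩, x, h⟩, fun h => ⟨h.1.1, h.1.2.symm⟩⟩
    _ ≤ ∑ y ∈ Λ.biUnion fun x => G.neighborFinset x, κ * e * (wgt G o α y * F y) := by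
        refine Finset.sum_le_sum fun y _ => ?_
        have h0 : 0 ≤ κ * e * (wgt G o α y * F y) :=
          mul_nonneg (mul_nonneg hκ he) (mul_nonneg (hw y) (hF y))
        rw [Finset.sum_const, nsmul_eq_mul]
        have hcard : ((Λ ∩ G.neighborFinset y).card : ℝ) ≤ G.degree y := by
          rw [← SimpleGraph.card_neighborFinset_eq_degree]
          exact_mod_cast Finset.card_le_card Finset.inter_subset_right
        calc _ ≤ (G.degree y : ℝ) * (κ * e * (wgt G o α y * F y) / G.degree y) := by gcongr
          _ = (G.degree y / G.degree y : ℝ) * (κ * e * (wgt G o α y * F y)) := by ring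
          _ ≤ 1 * (κ * e * (wgt G o α y * F y)) := by
              gcongr
              exact div_self_le_one _
          _ = _ := one_mul _
    _ = _ := by rw [Finset.mul_sum]

theorem summable_wgt (G : SimpleGraph V) [∀ v : V, Fintype (G.neighborSet v)]
    (hconn : G.Connected) (o : V) {α θ : ℝ} (hθ : 0 < θ) (hΘ : ThetaFin G o α θ) :
    Summable (wgt G o α) := by
  rcases subsingleton_or_nontrivial V with h | h
  · exact Summable.of_finite
  · refine Summable.of_nonneg_of_le (fun x => Real.exp_nonneg _) (fun x => ?_) hΘ
    have h1 : (1 : ℝ) ≤ G.degree x := by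
      exact_mod_cast hconn.preconnected.degree_pos_of_nontrivial x
    have h2 : 1 ≤ edgeMass G θ x := h1.trans (degree_le_edgeMass G hθ x)
    exact le_mul_of_one_le_left (Real.exp_nonneg _) h2

/-- **Uniform single-site moment bound for the specification.** For every `λ > 0`,
`p ∈ [p₀,q)`, `α ∈ (α_,ᾱ]`, `ξ ∈ L^p(V,w_α)` and `x ∈ V`, there is `C(λ,p,x,ξ) > 0`,
independent of `Λ`, such that for every finite `Λ ∋ x`:
`log ∫ exp(λ|ω(x)|^p) π_Λ(dω|ξ) ≤ C(λ,p,x,ξ)`. -/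
theorem uniform_single_site_moment_bound
    (G : SimpleGraph V) [∀ v : V, Fintype (G.neighborSet v)] (hconn : G.Connected)
    (o : V) (θ : ℝ) (hθ : 0 < θ)
    (αlow αbar : ℝ) (hαlow : αlow = sInf {α : ℝ | ThetaFin G o α θ})
    (hbar : αlow < αbar) (hΘ : ∀ α ∈ Set.Ioc αlow αbar, ThetaFin G o α θ)
    (W : ℝ → ℝ → ℝ) (hWcont : Continuous (Function.uncurry W))
    (hWsym : ∀ u v : ℝ, W u v = W v u)
    (IW JW r : ℝ) (hIW : 0 < IW) (hJW : 0 < JW) (hr : 0 < r)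
    (hW : ∀ u v : ℝ, |W u v| ≤ (IW + JW * (|u| ^ r + |v| ^ r)) / 2)
    (P : ℝ → ℝ) (hPcont : Continuous P)
    (aV cV q : ℝ) (haV : 0 < aV) (hcV : 0 < cV) (hq : r + r / θ < q)
    (hP : ∀ u : ℝ, aV * |u| ^ q - cV ≤ P u)
    (lam p α : ℝ) (hlam : 0 < lam) (hp : p ∈ Set.Ico (r + r / θ) q)
    (hα : α ∈ Set.Ioc αlow αbar)
    (ξ : V → ℝ) (hξ : ξ ∈ tempered G o p α) (x : V) :
    ∃ C : ℝ, 0 < C ∧ ∀ Λ : Finset V, x ∈ Λ →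
      ∫⁻ ω, ENNReal.ofReal (Real.exp (lam * |ω x| ^ p)) ∂(gibbsKer G W P Λ ξ) ≤
        ENNReal.ofReal (Real.exp C) := by
  have hΘα := hΘ α hα
  have hsw := summable_wgt G hconn o hθ hΘα
  have hw0 : ∀ y, 0 < wgt G o α y := fun y => Real.exp_pos _
  set e := Real.exp |α|
  have he1 : 1 ≤ e := Real.one_le_exp (abs_nonneg α)
  have he0 : 0 < e := Real.exp_pos _
  set κ := lam / (2 * e)
  have hκ : 0 < κ := by positivity
  have hκlam : κ ≤ lam := div_le_self hlam.le (by linarith)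
  obtain ⟨C, hC, hsys⟩ := exists_log_moment_system G hθ hWcont hWsym hIW hJW hr hW hPcont haV hcV
    hP hlam hp hκ hκlam
  have hsum1 : Summable fun y => wgt G o α y * (1 + edgeMass G θ y) :=
    (hsw.add hΘα).congr fun y => by simp only [edgeMass]; ring
  set S1 := ∑' y, wgt G o α y * (1 + edgeMass G θ y)
  set S2 := ∑' y, |ξ y| ^ p * wgt G o α y
  set S := C * S1 + lam / 2 * S2
  refine ⟨|2 * S / wgt G o α x| + 1, by positivity, fun Λ hx => ?_⟩
  obtain ⟨M, hM0, hME, hMsys⟩ := hsys Λ ξ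
  rw [hME x hx]
  refine ENNReal.ofReal_le_ofReal (Real.exp_le_exp.2 ?_)
  set F : V → ℝ := fun y => if y ∈ Λ then M y / lam else |ξ y| ^ p
  have hF : ∀ y, 0 ≤ F y := fun y => by
    simp only [F]
    split_ifs with h
    · exact div_nonneg (hM0 y h) hlam.le
    · exact rpow_nonneg (abs_nonneg _) _
  have hκe : κ * e = lam / 2 := by
    simp only [κ]
    field_simp
  have hcol := sum_wgt_mul_sum_neighbor_le G hconn o α hκ.le Λ hF
  set U := Λ.biUnion fun x => G.neighborFinset x
  have h1 : ∑ y ∈ U, wgt G o α y * F y ≤ (∑ y ∈ Λ, wgt G o α y * M y) / lam + S2 := by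
    rw [← Finset.sum_inter_add_sum_sdiff U Λ]
    refine add_le_add ?_ ?_
    · rw [Finset.sum_div]
      calc ∑ y ∈ U ∩ Λ, wgt G o α y * F y ≤ ∑ y ∈ Λ, wgt G o α y * F y :=
            Finset.sum_le_sum_of_subset_of_nonneg Finset.inter_subset_right
              fun y _ _ => mul_nonneg (hw0 y).le (hF y)
        _ = _ := Finset.sum_congr rfl fun y hy => by
            simp only [F, if_pos hy, mul_div_assoc]
    · calc ∑ y ∈ U \ Λ, wgt G o α y * F y = ∑ y ∈ U \ Λ, |ξ y| ^ p * wgt G o α y :=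
            Finset.sum_congr rfl fun y hy => by
              simp only [F, if_neg (Finset.mem_sdiff.1 hy).2, mul_comm]
        _ ≤ S2 := Summable.sum_le_tsum _
            (fun y _ => mul_nonneg (rpow_nonneg (abs_nonneg _) _) (hw0 y).le) hξ
  have h2 : ∑ y ∈ Λ, wgt G o α y * (1 + edgeMass G θ y) ≤ S1 :=
    Summable.sum_le_tsum _ (fun y _ => mul_nonneg (hw0 y).le
      (by linarith [edgeMass_nonneg G θ y])) hsum1
  have h3 := le_of_weighted_contraction Λ (wgt G o α) M (fun x => C * (1 + edgeMass G θ x)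
    + ∑ y ∈ G.neighborFinset x, κ / (G.degree x * G.degree y) * F y) S hw0 hM0 hMsys
    (by
      calc ∑ x ∈ Λ, wgt G o α x * (C * (1 + edgeMass G θ x)
            + ∑ y ∈ G.neighborFinset x, κ / (G.degree x * G.degree y) * F y)
          = C * ∑ y ∈ Λ, wgt G o α y * (1 + edgeMass G θ y) + ∑ x ∈ Λ, wgt G o α x *
              ∑ y ∈ G.neighborFinset x, κ / (G.degree x * G.degree y) * F y := by
            rw [Finset.mul_sum, ← Finset.sum_add_distrib]
            exact Finset.sum_congr rfl fun y _ => by ring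
        _ ≤ C * S1 + lam / 2 * ((∑ y ∈ Λ, wgt G o α y * M y) / lam + S2) := by
            refine add_le_add (mul_le_mul_of_nonneg_left h2 hC) (hcol.trans ?_)
            rw [hκe]
            exact mul_le_mul_of_nonneg_left h1 (half_pos hlam).le
        _ = S + (∑ x ∈ Λ, wgt G o α x * M x) / 2 := by
            simp only [S]
            field_simp
            ring) hx
  linarith [le_abs_self (2 * S / wgt G o α x)]
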